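/- For all α, β, ν ∈ ℤ[1/n] and every d ∈ ℤ, the image of the element aᵛ tᵈ of BS(1,n) under the type-I endomorphism ψ^I_{α,β} is a^{να + ((n^d − 1)/(n − 1))β} t^d, where (n^d − 1)/(n − 1) ∈ ℤ[1/n]. -/

import Mathlib

/-- The defining relator set of the Baumslag–Solitar group `BS(1,n)`:
generators `false ↦ a`, `true ↦ t`, relator `t⁻¹ aⁿ t a⁻¹`. -/
def bsRels (n : ℤ) : Set (FreeGroup Bool) :=
  {(FreeGroup.of true)⁻¹ * (FreeGroup.of false) ^ n * FreeGroup.of true * (FreeGroup.of false)⁻¹}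

/-- The solvable Baumslag–Solitar group `BS(1,n) = ⟨a, t ∣ t⁻¹ aⁿ t = a⟩`. -/
abbrev BS (n : ℤ) := PresentedGroup (bsRels n)

/-- The generator `a` of `BS(1,n)`. -/
def BS.a (n : ℤ) : BS n := PresentedGroup.of false

/-- The generator `t` of `BS(1,n)`. -/
def BS.t (n : ℤ) : BS n := PresentedGroup.of true

/-- `ℤ[1/n]` as a set of rationals: those of the form `k / n^p`. -/
def zInv (n : ℤ) : Set ℚ := {x : ℚ | ∃ (k : ℤ) (p : ℕ), x = (k : ℚ) / (n : ℚ) ^ p}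

open Classical in
/-- For `α = k/n^p ∈ ℤ[1/n]`, the element `a^α := t⁻ᵖ aᵏ tᵖ` of `BS(1,n)`
(junk value `1` if `α ∉ ℤ[1/n]`). -/
noncomputable def apow (n : ℤ) (α : ℚ) : BS n :=
  if h : ∃ kp : ℤ × ℕ, α = (kp.1 : ℚ) / (n : ℚ) ^ kp.2 then
    BS.t n ^ (-(h.choose.2 : ℤ)) * BS.a n ^ h.choose.1 * BS.t n ^ (h.choose.2 : ℤ)
  else 1

/-- `u` and `v` are `ψ`-twisted conjugate: `v = ψ(x)⁻¹ u x` for some `x`. -/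
def twistedConj {G : Type*} [Group G] (ψ : G →* G) (u v : G) : Prop :=
  ∃ x : G, v = (ψ x)⁻¹ * u * x

theorem BS.t_mul_a (n : ℤ) : BS.t n * BS.a n = BS.a n ^ n * BS.t n := by
  have h : (BS.t n)⁻¹ * BS.a n ^ n * BS.t n * (BS.a n)⁻¹ = 1 := by
    have := PresentedGroup.one_of_mem (rels := bsRels n)
      (x := (FreeGroup.of true)⁻¹ * (FreeGroup.of false) ^ n * FreeGroup.of true *
        (FreeGroup.of false)⁻¹) rfl
    simp only [map_mul, map_inv, map_zpow] at this
    exact this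
  rw [mul_inv_eq_one, mul_assoc, inv_mul_eq_iff_eq_mul] at h
  exact h.symm

theorem BS.t_conj_a_zpow (n k : ℤ) :
    BS.t n * BS.a n ^ k * (BS.t n)⁻¹ = BS.a n ^ (n * k) := by
  rw [← conj_zpow, BS.t_mul_a, mul_inv_cancel_right, zpow_mul]

theorem BS.t_pow_conj_a_zpow (n k : ℤ) (q : ℕ) :
    BS.t n ^ q * BS.a n ^ k * (BS.t n ^ q)⁻¹ = BS.a n ^ (n ^ q * k) := by
  induction q with
  | zero => simp
  | succ q ih =>
    have h : BS.t n ^ (q + 1) * BS.a n ^ k * (BS.t n ^ (q + 1))⁻¹ =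
        BS.t n * (BS.t n ^ q * BS.a n ^ k * (BS.t n ^ q)⁻¹) * (BS.t n)⁻¹ := by
      rw [pow_succ']; group
    rw [h, ih, BS.t_conj_a_zpow, pow_succ', mul_assoc]

theorem BS.conj_a_zpow_add (n k : ℤ) (p q : ℕ) :
    (BS.t n ^ (p + q))⁻¹ * BS.a n ^ (n ^ q * k) * BS.t n ^ (p + q) =
      (BS.t n ^ p)⁻¹ * BS.a n ^ k * BS.t n ^ p := by
  rw [← BS.t_pow_conj_a_zpow, add_comm p q, pow_add]; group

theorem apow_div_pow {n : ℤ} (hn : n ≠ 0) (k : ℤ) (p : ℕ) :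
    apow n ((k : ℚ) / (n : ℚ) ^ p) = (BS.t n ^ p)⁻¹ * BS.a n ^ k * BS.t n ^ p := by
  have h : ∃ kp : ℤ × ℕ, (k : ℚ) / (n : ℚ) ^ p = (kp.1 : ℚ) / (n : ℚ) ^ kp.2 := ⟨(k, p), rfl⟩
  have hn' : (n : ℚ) ≠ 0 := by exact_mod_cast hn
  have hc := h.choose_spec
  rw [apow, dif_pos h]
  generalize h.choose = kp at hc
  obtain ⟨l, q⟩ := kp
  rw [div_eq_div_iff (pow_ne_zero _ hn') (pow_ne_zero _ hn')] at hc
  have hkl : n ^ p * l = n ^ q * k := by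
    have : k * n ^ q = l * n ^ p := by exact_mod_cast hc
    linarith
  simp only [zpow_neg, zpow_natCast]
  rw [← BS.conj_a_zpow_add n l q p, ← BS.conj_a_zpow_add n k p q, hkl, add_comm q p]

theorem zInv_common_denom {n : ℤ} (hn : n ≠ 0) {x y : ℚ} (hx : x ∈ zInv n) (hy : y ∈ zInv n) :
    ∃ (k l : ℤ) (p : ℕ), x = (k : ℚ) / (n : ℚ) ^ p ∧ y = (l : ℚ) / (n : ℚ) ^ p := by
  obtain ⟨k, p, rfl⟩ := hx
  obtain ⟨l, q, rfl⟩ := hy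
  have hn' : (n : ℚ) ≠ 0 := by exact_mod_cast hn
  refine ⟨k * n ^ q, l * n ^ p, p + q, ?_, ?_⟩ <;> push_cast <;> rw [pow_add] <;> field_simp

theorem zInv_add {n : ℤ} (hn : n ≠ 0) {x y : ℚ} (hx : x ∈ zInv n) (hy : y ∈ zInv n) :
    x + y ∈ zInv n := by
  obtain ⟨k, l, p, rfl, rfl⟩ := zInv_common_denom hn hx hy
  exact ⟨k + l, p, by push_cast; ring⟩

theorem zInv_mul {n : ℤ} {x y : ℚ} (hx : x ∈ zInv n) (hy : y ∈ zInv n) : x * y ∈ zInv n := by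
  obtain ⟨k, p, rfl⟩ := hx
  obtain ⟨l, q, rfl⟩ := hy
  exact ⟨k * l, p + q, by push_cast; rw [pow_add, div_mul_div_comm]⟩

theorem intCast_mem_zInv (n k : ℤ) : (k : ℚ) ∈ zInv n := ⟨k, 0, by simp⟩

theorem zInv_neg {n : ℤ} {x : ℚ} (hx : x ∈ zInv n) : -x ∈ zInv n := by
  obtain ⟨k, p, rfl⟩ := hx
  exact ⟨-k, p, by push_cast; ring⟩

theorem zpow_mem_zInv (n d : ℤ) : (n : ℚ) ^ d ∈ zInv n := by
  obtain ⟨m, rfl | rfl⟩ := d.eq_nat_or_neg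
  · exact ⟨n ^ m, 0, by simp⟩
  · exact ⟨1, m, by simp⟩

theorem zpow_geom_add_one {n : ℚ} (h0 : n ≠ 0) (h1 : n - 1 ≠ 0) (d : ℤ) :
    (n ^ (d + 1) - 1) / (n - 1) = (n ^ d - 1) / (n - 1) + n ^ d := by
  rw [zpow_add_one₀ h0]; field_simp; ring

theorem zpow_geom_mem_zInv {n : ℤ} (h0 : n ≠ 0) (h1 : n ≠ 1) (d : ℤ) :
    ((n : ℚ) ^ d - 1) / ((n : ℚ) - 1) ∈ zInv n := by
  have h0' : (n : ℚ) ≠ 0 := by exact_mod_cast h0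
  have h1' : (n : ℚ) - 1 ≠ 0 := sub_ne_zero.mpr (by exact_mod_cast h1)
  induction d using Int.induction_on with
  | zero => simpa using intCast_mem_zInv n 0
  | succ d ih =>
    rw [zpow_geom_add_one h0' h1']
    exact zInv_add h0 ih (zpow_mem_zInv n d)
  | pred d ih =>
    have h := zpow_geom_add_one h0' h1' (-(d : ℤ) - 1)
    rw [sub_add_cancel] at h
    rw [eq_sub_of_add_eq h.symm, sub_eq_add_neg]
    exact zInv_add h0 ih (zInv_neg (zpow_mem_zInv n _))

theorem apow_zero {n : ℤ} (hn : n ≠ 0) : apow n 0 = 1 := by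
  simpa using apow_div_pow hn 0 0

theorem apow_add {n : ℤ} (hn : n ≠ 0) {x y : ℚ} (hx : x ∈ zInv n) (hy : y ∈ zInv n) :
    apow n (x + y) = apow n x * apow n y := by
  obtain ⟨k, l, p, rfl, rfl⟩ := zInv_common_denom hn hx hy
  rw [← add_div, ← Int.cast_add, apow_div_pow hn, apow_div_pow hn, apow_div_pow hn]
  group

theorem apow_intCast_mul {n : ℤ} (hn : n ≠ 0) (m : ℤ) {x : ℚ} (hx : x ∈ zInv n) :
    apow n (m * x) = apow n x ^ m := by
  obtain ⟨k, p, rfl⟩ := hx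
  have h := conj_zpow (i := m) (a := (BS.t n ^ p)⁻¹) (b := BS.a n ^ k)
  rw [inv_inv] at h
  rw [← mul_div_assoc, ← Int.cast_mul, apow_div_pow hn, apow_div_pow hn, h, ← zpow_mul, mul_comm m]

theorem t_mul_apow {n : ℤ} (hn : n ≠ 0) {x : ℚ} (hx : x ∈ zInv n) :
    BS.t n * apow n x = apow n (n * x) * BS.t n := by
  obtain ⟨k, p, rfl⟩ := hx
  rw [← mul_div_assoc, ← Int.cast_mul, apow_div_pow hn, apow_div_pow hn, ← BS.t_conj_a_zpow]
  group

/-- Conjugation by `t` multiplies exponents by `n`, and so does conjugation by any `aᵝ t`. -/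
theorem semiconjBy_apow {n : ℤ} (hn : n ≠ 0) {β x : ℚ} (hβ : β ∈ zInv n) (hx : x ∈ zInv n) :
    SemiconjBy (apow n β * BS.t n) (apow n x) (apow n (n * x)) := by
  have hnx : (n : ℚ) * x ∈ zInv n := zInv_mul (intCast_mem_zInv n n) hx
  rw [SemiconjBy, mul_assoc, t_mul_apow hn hx, ← mul_assoc, ← mul_assoc, ← apow_add hn hβ hnx,
    ← apow_add hn hnx hβ, add_comm]

theorem semiconjBy_zpow_apow {n : ℤ} (hn : n ≠ 0) {β x : ℚ} (hβ : β ∈ zInv n) (hx : x ∈ zInv n)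
    (d : ℤ) :
    SemiconjBy ((apow n β * BS.t n) ^ d) (apow n x) (apow n ((n : ℚ) ^ d * x)) := by
  have hn' : (n : ℚ) ≠ 0 := by exact_mod_cast hn
  induction d using Int.induction_on with
  | zero => simp [SemiconjBy]
  | succ d ih =>
    have h := (semiconjBy_apow hn hβ (zInv_mul (zpow_mem_zInv n d) hx)).mul_left ih
    rwa [← mul_assoc, ← zpow_one_add₀ hn', ← zpow_one_add, add_comm] at h
  | pred d ih =>
    have h := semiconjBy_apow hn hβ (zInv_mul (zpow_mem_zInv n (-(d : ℤ) - 1)) hx)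
    rw [← mul_assoc, ← zpow_one_add₀ hn', add_sub_cancel] at h
    have h' := h.inv_symm_left.mul_left ih
    rwa [← zpow_neg_one, ← zpow_add, neg_add_eq_sub] at h'

theorem t_zpow_mul_apow {n : ℤ} (hn : n ≠ 0) {x : ℚ} (hx : x ∈ zInv n) (d : ℤ) :
    BS.t n ^ d * apow n x = apow n ((n : ℚ) ^ d * x) * BS.t n ^ d := by
  have h := semiconjBy_zpow_apow hn (by simpa using intCast_mem_zInv n 0) hx d
  rwa [apow_zero hn, one_mul] at h

theorem apow_mul_t_zpow {n : ℤ} (h0 : n ≠ 0) (h1 : n ≠ 1) {β : ℚ} (hβ : β ∈ zInv n) (d : ℤ) :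
    (apow n β * BS.t n) ^ d =
      apow n (((n : ℚ) ^ d - 1) / ((n : ℚ) - 1) * β) * BS.t n ^ d := by
  have h0' : (n : ℚ) ≠ 0 := by exact_mod_cast h0
  have h1' : (n : ℚ) - 1 ≠ 0 := sub_ne_zero.mpr (by exact_mod_cast h1)
  have step (d : ℤ) : apow n (((n : ℚ) ^ (d + 1) - 1) / ((n : ℚ) - 1) * β) * BS.t n ^ (d + 1) =
      apow n (((n : ℚ) ^ d - 1) / ((n : ℚ) - 1) * β) * BS.t n ^ d * (apow n β * BS.t n) := by
    rw [zpow_geom_add_one h0' h1', add_mul, apow_add h0 (zInv_mul (zpow_geom_mem_zInv h0 h1 d) hβ)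
      (zInv_mul (zpow_mem_zInv n d) hβ), zpow_add_one, ← mul_assoc, ← mul_assoc,
      mul_assoc _ (BS.t n ^ d) (apow n β), t_zpow_mul_apow h0 hβ, ← mul_assoc]
  induction d using Int.induction_on with
  | zero => simp [apow_zero h0]
  | succ d ih => rw [step, ← ih, zpow_add_one]
  | pred d ih =>
    have h := step (-(d : ℤ) - 1)
    rw [sub_add_cancel, ← ih] at h
    rw [zpow_sub_one, h, mul_inv_cancel_right]

theorem map_apow {n : ℤ} (hn : n ≠ 0) {α β ν : ℚ} (hα : α ∈ zInv n) (hβ : β ∈ zInv n)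
    (hν : ν ∈ zInv n) {ψ : BS n →* BS n} (ha : ψ (BS.a n) = apow n α)
    (ht : ψ (BS.t n) = apow n β * BS.t n) : ψ (apow n ν) = apow n (ν * α) := by
  obtain ⟨k, p, rfl⟩ := hν
  have hn' : (n : ℚ) ≠ 0 := by exact_mod_cast hn
  have hmem : (k : ℚ) / (n : ℚ) ^ p * α ∈ zInv n := zInv_mul ⟨k, p, rfl⟩ hα
  have h := semiconjBy_zpow_apow hn hβ hmem p
  have hk : (n : ℚ) ^ (p : ℤ) * ((k : ℚ) / (n : ℚ) ^ p * α) = k * α := by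
    rw [zpow_natCast]; field_simp
  rw [hk, apow_intCast_mul hn k hα, zpow_natCast] at h
  rw [apow_div_pow hn, map_mul, map_mul, map_inv, map_pow, map_zpow, ha, ht, mul_assoc, ← h.eq,
    inv_mul_cancel_left]

/-- the image of a^ν t^d under ψ^I_{α,β} is
a^{να + ((n^d−1)/(n−1))β} t^d, with (n^d−1)/(n−1) ∈ ℤ[1/n]. -/
theorem typeI_action (n : ℤ) (hn : n ∉ ({0, 1, -1} : Set ℤ))
    (α β ν : ℚ) (hα : α ∈ zInv n) (hβ : β ∈ zInv n) (hν : ν ∈ zInv n) (d : ℤ)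
    (ψ : BS n →* BS n)
    (ha : ψ (BS.a n) = apow n α) (ht : ψ (BS.t n) = apow n β * BS.t n) :
    ((n : ℚ) ^ d - 1) / ((n : ℚ) - 1) ∈ zInv n ∧
    ψ (apow n ν * BS.t n ^ d) =
      apow n (ν * α + ((n : ℚ) ^ d - 1) / ((n : ℚ) - 1) * β) * BS.t n ^ d := by
  have h0 : n ≠ 0 := fun h => hn (by simp [h])
  have h1 : n ≠ 1 := fun h => hn (by simp [h])
  have hc := zpow_geom_mem_zInv h0 h1 d
  refine ⟨hc, ?_⟩
  rw [map_mul, map_zpow, map_apow h0 hα hβ hν ha ht, ht, apow_mul_t_zpow h0 h1 hβ,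
    apow_add h0 (zInv_mul hν hα) (zInv_mul hc hβ), mul_assoc]
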